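/- For i = 1,…,K let H_{i,j} (j = 1,…,K) be M×M complex matrices, Q_j be M×n_j complex matrices, and let each transmitter i have a finite set of codewords x_i^{[1]}, …, x_i^{[P_i]} ∈ ℂ^{n_i}. Fix σ² > 0 and define C({Q_l}) = Σᵢ Σⱼ log₂(Σₖ exp(−d_i^{[jk]})) where d_i^{[jk]} = (x_i^{[j]} − x_i^{[k]})ᴴQ_iᴴH_{i,i}ᴴ(Σ_{l≠i}H_{i,l}Q_l(H_{i,l}Q_l)ᴴ + σ²·I)⁻¹H_{i,i}Q_i(x_i^{[j]} − x_i^{[k]}). If at least one vector H_{i,i}Q_i(x_i^{[j]} − x_i^{[k]}) is nonzero, then for every ε ∈ (0,1), C({√(1−ε) · Q_l}) > C({Q_l}); that is, uniformly scaling down all precoders strictly increases the minimization objective. -/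

import Mathlib

open Matrix

/-- The distance measure `d_i^{[jk]}` between codewords `x_i^{[j]}` and `x_i^{[k]}`
at receiver `i` (equations (3)–(4) of the FIA paper). -/
noncomputable def distIK {K M : ℕ} (n : Fin K → ℕ) (P : Fin K → ℕ)
    (H : Fin K → Fin K → Matrix (Fin M) (Fin M) ℂ)
    (Q : ∀ j, Matrix (Fin M) (Fin (n j)) ℂ)
    (x : ∀ i, Fin (P i) → Fin (n i) → ℂ)
    (i : Fin K) (j k : Fin (P i)) (s : ℝ) : ℂ :=
  star ((H i i * Q i) *ᵥ (x i j - x i k)) ⬝ᵥ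
    ((∑ l ∈ Finset.univ.erase i, (H i l * Q l) * (H i l * Q l)ᴴ + (s : ℂ) • 1)⁻¹ *ᵥ
      ((H i i * Q i) *ᵥ (x i j - x i k)))

/-- `C({Q_l}) = Σᵢ Σⱼ log₂ (Σₖ exp(−d_i^{[jk]}))`, the minimization form of the
finite-alphabet mutual-information objective, as a function of the precoders. -/
noncomputable def objC {K M : ℕ} (n : Fin K → ℕ) (P : Fin K → ℕ)
    (H : Fin K → Fin K → Matrix (Fin M) (Fin M) ℂ)
    (Q : ∀ j, Matrix (Fin M) (Fin (n j)) ℂ)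
    (x : ∀ i, Fin (P i) → Fin (n i) → ℂ) (s : ℝ) : ℝ :=
  ∑ i : Fin K, ∑ j : Fin (P i),
    Real.logb 2 (∑ k : Fin (P i), Real.exp (-(distIK n P H Q x i j k s).re))

open scoped ComplexOrder

/-- Adding a positive multiple of the identity to a positive definite matrix strictly decreases the
quadratic form of its inverse. -/
theorem Matrix.PosDef.re_dotProduct_inv_add_smul_one_lt {m : Type*} [Fintype m] [DecidableEq m]
    {A : Matrix m m ℂ} (hA : A.PosDef) {δ : ℝ} (hδ : 0 < δ) {v : m → ℂ} (hv : v ≠ 0) :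
    (star v ⬝ᵥ ((A + (δ : ℂ) • 1)⁻¹ *ᵥ v)).re < (star v ⬝ᵥ (A⁻¹ *ᵥ v)).re := by
  have hB : (A + (δ : ℂ) • 1).PosDef :=
    hA.add (PosDef.one.smul (by exact_mod_cast hδ : (0 : ℂ) < δ))
  set B := A + (δ : ℂ) • 1 with hBdef
  have hAu : IsUnit A.det := (isUnit_iff_isUnit_det A).1 hA.isUnit
  have hBu : IsUnit B.det := (isUnit_iff_isUnit_det B).1 hB.isUnit
  set w := B⁻¹ *ᵥ v with hw
  have hBw : v = A *ᵥ w + (δ : ℂ) • w := by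
    have h : B *ᵥ w = v := by rw [hw, mulVec_mulVec, mul_nonsing_inv _ hBu, one_mulVec]
    rw [← h, hBdef, add_mulVec, smul_mulVec, one_mulVec]
  have hw0 : w ≠ 0 := by
    intro h
    apply hv
    rw [hBw, h]
    simp
  have hAv : A⁻¹ *ᵥ v = w + (δ : ℂ) • (A⁻¹ *ᵥ w) := by
    conv_lhs => rw [hBw]
    rw [mulVec_add, mulVec_smul, mulVec_mulVec, nonsing_inv_mul _ hAu, one_mulVec]
  have hAw : star (A *ᵥ w) ⬝ᵥ (A⁻¹ *ᵥ w) = star w ⬝ᵥ w := by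
    rw [star_mulVec, hA.isHermitian.eq, ← dotProduct_mulVec, mulVec_mulVec,
      mul_nonsing_inv _ hAu, one_mulVec]
  have hvw : star v ⬝ᵥ (A⁻¹ *ᵥ w) = star w ⬝ᵥ w + δ * (star w ⬝ᵥ (A⁻¹ *ᵥ w)) := by
    conv_lhs => rw [hBw]
    rw [star_add, add_dotProduct, hAw, star_smul, smul_dotProduct, smul_eq_mul]
    simp
  have hpos : 0 < (star w ⬝ᵥ w).re :=
    (Complex.lt_def.1 (dotProduct_star_self_pos_iff.2 hw0)).1
  have hinv : 0 < (star w ⬝ᵥ (A⁻¹ *ᵥ w)).re :=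
    (Complex.lt_def.1 (hA.inv.dotProduct_mulVec_pos hw0)).1
  rw [hAv, dotProduct_add, dotProduct_smul, hvw, smul_eq_mul, Complex.add_re,
    Complex.re_ofReal_mul, Complex.add_re, Complex.re_ofReal_mul]
  have : 0 < δ * ((star w ⬝ᵥ w).re + δ * (star w ⬝ᵥ (A⁻¹ *ᵥ w)).re) := by positivity
  linarith

section

variable {K M : ℕ} (n : Fin K → ℕ) (P : Fin K → ℕ)
  (H : Fin K → Fin K → Matrix (Fin M) (Fin M) ℂ)
  (Q : ∀ j, Matrix (Fin M) (Fin (n j)) ℂ)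
  (x : ∀ i, Fin (P i) → Fin (n i) → ℂ)

/-- The interference-plus-noise covariance is positive definite. -/
theorem posDef_interference_add_noise (i : Fin K) {s : ℝ} (hs : 0 < s) :
    (∑ l ∈ Finset.univ.erase i, (H i l * Q l) * (H i l * Q l)ᴴ + (s : ℂ) • 1).PosDef :=
  PosDef.posSemidef_add (posSemidef_sum _ fun _ _ => posSemidef_self_mul_conjTranspose _)
    (PosDef.one.smul (by exact_mod_cast hs : (0 : ℂ) < s))

/-- Scaling all precoders by `c` is equivalent to dividing the noise power by `c ^ 2`. -/
theorem distIK_smul {c : ℝ} (hc : c ≠ 0) {s : ℝ} (hs : 0 < s) (i : Fin K) (j k : Fin (P i)) :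
    distIK n P H (fun l => (c : ℂ) • Q l) x i j k s = distIK n P H Q x i j k (s / c ^ 2) := by
  have hc' : (c : ℂ) ≠ 0 := by exact_mod_cast hc
  have hA := posDef_interference_add_noise n H Q i (s := s / c ^ 2) (by positivity)
  have hAu := (isUnit_iff_isUnit_det _).1 hA.isUnit
  have hcov : ∑ l ∈ Finset.univ.erase i, (H i l * ((c : ℂ) • Q l)) * (H i l * ((c : ℂ) • Q l))ᴴ
      + (s : ℂ) • 1 = Units.mk0 ((c : ℂ) ^ 2) (pow_ne_zero 2 hc') •
      (∑ l ∈ Finset.univ.erase i, (H i l * Q l) * (H i l * Q l)ᴴ + ((s / c ^ 2 : ℝ) : ℂ) • 1) := by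
    rw [Units.smul_mk0, smul_add, Finset.smul_sum, smul_smul]
    congr 1
    · refine Finset.sum_congr rfl fun l _ => ?_
      simp only [Matrix.mul_smul, Matrix.smul_mul, conjTranspose_smul, smul_smul, sq,
        RCLike.star_def, Complex.conj_ofReal]
    · congr 1
      push_cast
      field_simp
  unfold distIK
  rw [hcov, inv_smul' _ _ hAu]
  simp only [Matrix.mul_smul, smul_mulVec, mulVec_smul, star_smul, smul_dotProduct,
    dotProduct_smul, Units.smul_def, smul_eq_mul, Units.val_inv_eq_inv_val, Units.val_mk0,
    RCLike.star_def, Complex.conj_ofReal]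
  field_simp

/-- The distance measure strictly decreases in the noise power when the received error vector is
nonzero. -/
theorem distIK_re_lt {s t : ℝ} (hs : 0 < s) (hst : s < t) {i : Fin K} {j k : Fin (P i)}
    (hne : (H i i * Q i) *ᵥ (x i j - x i k) ≠ 0) :
    (distIK n P H Q x i j k t).re < (distIK n P H Q x i j k s).re := by
  have h := (posDef_interference_add_noise n H Q i hs).re_dotProduct_inv_add_smul_one_lt
    (sub_pos.2 hst) hne
  rw [add_assoc, ← add_smul, ← Complex.ofReal_add, add_sub_cancel] at h
  exact h

theorem distIK_re_le {s t : ℝ} (hs : 0 < s) (hst : s < t) (i : Fin K) (j k : Fin (P i)) :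
    (distIK n P H Q x i j k t).re ≤ (distIK n P H Q x i j k s).re := by
  by_cases h : (H i i * Q i) *ᵥ (x i j - x i k) = 0
  · simp [distIK, h]
  · exact (distIK_re_lt n P H Q x hs hst h).le

/-- The objective strictly increases in the noise power when some received error vector is
nonzero. -/
theorem objC_lt_objC_of_lt {s t : ℝ} (hs : 0 < s) (hst : s < t)
    (hne : ∃ (i : Fin K) (j k : Fin (P i)), (H i i * Q i) *ᵥ (x i j - x i k) ≠ 0) :
    objC n P H Q x s < objC n P H Q x t := by
  obtain ⟨i, j, k, hijk⟩ := hne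
  have hexp (i : Fin K) (j k : Fin (P i)) : Real.exp (-(distIK n P H Q x i j k s).re) ≤
      Real.exp (-(distIK n P H Q x i j k t).re) :=
    Real.exp_le_exp.2 (neg_le_neg (distIK_re_le n P H Q x hs hst i j k))
  have hpos (i : Fin K) (j : Fin (P i)) :
      0 < ∑ k : Fin (P i), Real.exp (-(distIK n P H Q x i j k s).re) :=
    Finset.sum_pos (fun _ _ => Real.exp_pos _) ⟨j, Finset.mem_univ j⟩
  have hlog (i : Fin K) (j : Fin (P i)) :
      Real.logb 2 (∑ k : Fin (P i), Real.exp (-(distIK n P H Q x i j k s).re)) ≤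
        Real.logb 2 (∑ k : Fin (P i), Real.exp (-(distIK n P H Q x i j k t).re)) :=
    Real.logb_le_logb_of_le one_lt_two (hpos i j) (Finset.sum_le_sum fun k _ => hexp i j k)
  refine Finset.sum_lt_sum (fun i _ => Finset.sum_le_sum fun j _ => hlog i j)
    ⟨i, Finset.mem_univ i, Finset.sum_lt_sum (fun j _ => hlog i j) ⟨j, Finset.mem_univ j, ?_⟩⟩
  refine Real.logb_lt_logb one_lt_two (hpos i j)
    (Finset.sum_lt_sum (fun k _ => hexp i j k) ⟨k, Finset.mem_univ k, ?_⟩)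
  exact Real.exp_lt_exp.2 (neg_lt_neg (distIK_re_lt n P H Q x hs hst hijk))

end

/-- Inequality (C.3) of the FIA paper: given a nonzero received error vector, uniformly
scaling all precoders down by `√(1−ε)` strictly increases the minimization objective. -/
theorem objC_scaling_down_increases {K M : ℕ} (n : Fin K → ℕ) (P : Fin K → ℕ)
    (H : Fin K → Fin K → Matrix (Fin M) (Fin M) ℂ)
    (Q : ∀ j, Matrix (Fin M) (Fin (n j)) ℂ)
    (x : ∀ i, Fin (P i) → Fin (n i) → ℂ)
    (s : ℝ) (hs : 0 < s)
    (hne : ∃ (i : Fin K) (j k : Fin (P i)), (H i i * Q i) *ᵥ (x i j - x i k) ≠ 0)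
    (eps : ℝ) (heps : eps ∈ Set.Ioo (0 : ℝ) 1) :
    objC n P H (fun l => ((Real.sqrt (1 - eps) : ℂ) • Q l)) x s >
      objC n P H Q x s := by
  obtain ⟨h0, h1⟩ := heps
  have hpos : 0 < 1 - eps := sub_pos.2 h1
  have hscale : objC n P H (fun l => ((Real.sqrt (1 - eps) : ℂ) • Q l)) x s =
      objC n P H Q x (s / (1 - eps)) := by
    unfold objC
    simp only [distIK_smul n P H Q x (Real.sqrt_pos.2 hpos).ne' hs, Real.sq_sqrt hpos.le]
  rw [hscale]
  refine objC_lt_objC_of_lt n P H Q x hs ?_ hne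
  rw [lt_div_iff₀ hpos]
  nlinarith
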